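/- Let n ≥ 3 and σ ∈ B_{n−1}. For i ∈ [n] let σ_i (respectively σ_{−i}) denote the signed permutation in B_n obtained from σ by inserting the entry n (respectively −n) in position i, i.e., σ_{±i} = [σ(1),…,σ(i−1), ±n, σ(i),…,σ(n−1)]. Then Σ_{i=1}^{n} [ t^{fd(σ_i)} q^{fmaj(σ_i)} + t^{fd(σ_{−i})} q^{fmaj(σ_{−i})} ] = t^{fd(σ)} q^{fmaj(σ)} · { 1 + q·[fd(σ)]_q + tq + tq(q−1)·[fd(σ)]_q + t²q²·([2n−2]_q − [fd(σ)]_q) }. -/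

import Mathlib

open Finset

/-- `π` is an element of the hyperoctahedral group `B_n`: a bijection of `ℤ`
satisfying `π (-a) = -π a` for all `a`, and fixing every `a` with `|a| > n`
(so it restricts to a bijection of `{-n,…,-1,1,…,n}`). -/
def IsSignedPerm (n : ℕ) (π : Equiv.Perm ℤ) : Prop :=
  (∀ a : ℤ, π (-a) = - π a) ∧ ∀ a : ℤ, (n : ℤ) < |a| → π a = a

/-- The hyperoctahedral group `B_n`, as a set of permutations of `ℤ`. -/
def BSet (n : ℕ) : Set (Equiv.Perm ℤ) := {π | IsSignedPerm n π}

/-- The descent set `Des_A(π) = {i ∈ [n-1] : π(i) > π(i+1)}`. -/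
def DesA (n : ℕ) (π : Equiv.Perm ℤ) : Finset ℕ :=
  (Finset.Icc 1 (n - 1)).filter fun i => π ((i : ℤ) + 1) < π (i : ℤ)

/-- `des_A(π)`, the number of descents of the window `π(1),…,π(n)`. -/
def desA (n : ℕ) (π : Equiv.Perm ℤ) : ℕ := (DesA n π).card

/-- `maj_A(π) = Σ_{i : π(i) > π(i+1)} i`. -/
def majA (n : ℕ) (π : Equiv.Perm ℤ) : ℕ := ∑ i ∈ DesA n π, i

/-- `Neg(π) = {i ∈ [n] : π(i) < 0}`. -/
def NegSet (n : ℕ) (π : Equiv.Perm ℤ) : Finset ℕ :=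
  (Finset.Icc 1 n).filter fun i => π (i : ℤ) < 0

/-- `neg(π) = |Neg(π)|`. -/
def negStat (n : ℕ) (π : Equiv.Perm ℤ) : ℕ := (NegSet n π).card

/-- `-Σ_{i ∈ Neg(π)} π(i) = Σ_{i ∈ Neg(π)} |π(i)|`, as a natural number. -/
def negSum (n : ℕ) (π : Equiv.Perm ℤ) : ℕ := ∑ i ∈ NegSet n π, (π (i : ℤ)).natAbs

/-- `inv(π) = #{(i,j) : 1 ≤ i < j ≤ n, π(i) > π(j)}`. -/
def invStat (n : ℕ) (π : Equiv.Perm ℤ) : ℕ :=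
  (((Finset.Icc 1 n) ×ˢ (Finset.Icc 1 n)).filter
    (fun p => p.1 < p.2 ∧ π ((p.2 : ℕ) : ℤ) < π ((p.1 : ℕ) : ℤ))).card

/-- The Coxeter length `ℓ(π) = inv(π) - Σ_{i ∈ Neg(π)} π(i)`. -/
def lenB (n : ℕ) (π : Equiv.Perm ℤ) : ℕ := invStat n π + negSum n π

/-- The negative major index `nmaj(π) = maj_A(π) - Σ_{i ∈ Neg(π)} π(i)`. -/
def nmaj (n : ℕ) (π : Equiv.Perm ℤ) : ℕ := majA n π + negSum n π

/-- The negative descent number `ndes(π) = des_A(π) + neg(π)`. -/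
def ndes (n : ℕ) (π : Equiv.Perm ℤ) : ℕ := desA n π + negStat n π

/-- The flag major index `fmaj(π) = 2 maj_A(π) + neg(π)`. -/
def fmaj (n : ℕ) (π : Equiv.Perm ℤ) : ℕ := 2 * majA n π + negStat n π

/-- The flag descent number `fd(π) = 2 des_A(π) + ε₁(π)`. -/
def fd (n : ℕ) (π : Equiv.Perm ℤ) : ℕ :=
  2 * desA n π + (if π 1 < 0 then 1 else 0)

/-- The symmetric group `S_n`, embedded in `B_n` as the signed permutations
with all window entries positive. -/
def SnSet (n : ℕ) : Set (Equiv.Perm ℤ) :=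
  {π | IsSignedPerm n π ∧ ∀ i ∈ Finset.Icc 1 n, 0 < π (i : ℤ)}

/-- `T = {π ∈ B_n : des_A(π) = 0}`. -/
def TSet (n : ℕ) : Set (Equiv.Perm ℤ) :=
  {π | IsSignedPerm n π ∧ desA n π = 0}

/-- The `q`-analogue `[m]_q = 1 + q + ⋯ + q^{m-1}`, with `q = X 1`. -/
noncomputable def qnumM (m : ℕ) : MvPolynomial (Fin 2) ℤ :=
  ∑ j ∈ Finset.range m, MvPolynomial.X 1 ^ j

/-- `τ ∈ B_n` is obtained from `σ ∈ B_{n-1}` by inserting the entry `v`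
in position `i`, i.e. `τ = [σ(1),…,σ(i-1), v, σ(i),…,σ(n-1)]`. -/
def InsertSpec (n : ℕ) (σ τ : Equiv.Perm ℤ) (i : ℕ) (v : ℤ) : Prop :=
  IsSignedPerm n τ ∧ ∀ j ∈ Finset.Icc 1 n,
    τ (j : ℤ) = if j < i then σ (j : ℤ) else if j = i then v else σ ((j : ℤ) - 1)

/-- The image of `D` under the increasing map `ℕ → ℕ` whose range misses exactly `i`. -/
def openGap (i : ℕ) (D : Finset ℕ) : Finset ℕ :=
  D.image fun k => if k < i then k else k + 1

lemma mem_openGap {i x : ℕ} {D : Finset ℕ} :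
    x ∈ openGap i D ↔ (x < i ∧ x ∈ D) ∨ (i < x ∧ x - 1 ∈ D) := by
  simp only [openGap, Finset.mem_image]
  constructor
  · rintro ⟨k, hk, rfl⟩
    split_ifs with h
    · exact Or.inl ⟨h, hk⟩
    · exact Or.inr ⟨by omega, by simpa using hk⟩
  · rintro (⟨h, hx⟩ | ⟨h, hx⟩)
    · exact ⟨x, hx, by simp [h]⟩
    · refine ⟨x - 1, hx, ?_⟩
      rw [if_neg (by omega)]
      omega

lemma openGap_injOn (i : ℕ) (s : Set ℕ) :
    Set.InjOn (fun k : ℕ => if k < i then k else k + 1) s := by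
  intro a _ b _ h
  dsimp only at h
  split_ifs at h <;> omega

lemma card_openGap (i : ℕ) (D : Finset ℕ) : (openGap i D).card = D.card :=
  Finset.card_image_of_injOn (openGap_injOn i _)

lemma sum_openGap (i : ℕ) (D : Finset ℕ) :
    ∑ k ∈ openGap i D, k = ∑ k ∈ D, k + (D.filter (i ≤ ·)).card := by
  rw [openGap, Finset.sum_image (openGap_injOn i _), Finset.card_filter,
    ← Finset.sum_add_distrib]
  refine Finset.sum_congr rfl fun k _ => ?_
  split_ifs <;> omega

lemma notMem_openGap (i : ℕ) (D : Finset ℕ) : i ∉ openGap i D := by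
  simp [mem_openGap]

lemma mem_DesA {n x : ℕ} {π : Equiv.Perm ℤ} :
    x ∈ DesA n π ↔ (1 ≤ x ∧ x ≤ n - 1) ∧ π ((x : ℤ) + 1) < π (x : ℤ) := by
  simp [DesA]

lemma mem_NegSet {n x : ℕ} {π : Equiv.Perm ℤ} :
    x ∈ NegSet n π ↔ (1 ≤ x ∧ x ≤ n) ∧ π (x : ℤ) < 0 := by
  simp [NegSet]

lemma IsSignedPerm.abs_apply_le {m : ℕ} {σ : Equiv.Perm ℤ} (hσ : IsSignedPerm m σ)
    {a : ℤ} (ha : |a| ≤ m) : |σ a| ≤ m := by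
  by_contra! h
  have := σ.injective (hσ.2 _ h)
  rw [this] at h
  omega

section Insertion

variable {m i : ℕ} {σ τ : Equiv.Perm ℤ} {v : ℤ}

lemma InsertSpec.apply_lt (h : InsertSpec (m + 1) σ τ i v) (hi : i ≤ m + 1) {j : ℕ}
    (hj : 1 ≤ j) (hji : j < i) : τ (j : ℤ) = σ (j : ℤ) := by
  rw [h.2 j (by simp; omega), if_pos hji]

lemma InsertSpec.apply_self (h : InsertSpec (m + 1) σ τ i v) (hi : i ≤ m + 1)
    (hi1 : 1 ≤ i) : τ (i : ℤ) = v := by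
  rw [h.2 i (by simp; omega), if_neg (by omega), if_pos rfl]

lemma InsertSpec.apply_succ (h : InsertSpec (m + 1) σ τ i v) {j : ℕ}
    (hjm : j ≤ m) (hij : i ≤ j) : τ ((j : ℤ) + 1) = σ (j : ℤ) := by
  have := h.2 (j + 1) (by simp; omega)
  rw [if_neg (by omega), if_neg (by omega)] at this
  simpa using this

lemma InsertSpec.mem_DesA_iff (h : InsertSpec (m + 1) σ τ i v) (hi1 : 1 ≤ i)
    (hi : i ≤ m + 1) (x : ℕ) :
    x ∈ DesA (m + 1) τ ↔ x ∈ openGap i ((DesA m σ).erase (i - 1)) ∨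
      (x = i ∧ i ≤ m ∧ σ (i : ℤ) < v) ∨ (x + 1 = i ∧ 1 ≤ x ∧ v < σ (x : ℤ)) := by
  have hself := h.apply_self hi hi1
  rw [mem_openGap, mem_DesA, Finset.mem_erase, Finset.mem_erase, mem_DesA, mem_DesA]
  rcases Nat.eq_zero_or_pos x with rfl | hx
  · simp; omega
  by_cases hxm : x ≤ m
  swap
  · constructor <;> intro h' <;> omega
  rcases lt_trichotomy (x + 1) i with h1 | h1 | h1
  · have e1 := h.apply_lt hi hx (by omega)
    have e2 := h.apply_lt hi (j := x + 1) (by omega) (by omega)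
    push_cast at e2
    rw [e1, e2]
    omega
  · have e1 := h.apply_lt hi hx (by omega)
    have e2 : τ ((x : ℤ) + 1) = v := by rw [← hself, ← h1]; push_cast; rfl
    rw [e1, e2]
    omega
  · rcases Nat.lt_or_ge i x with h2 | h2
    · obtain ⟨y, rfl⟩ : ∃ y, x = y + 1 := ⟨x - 1, by omega⟩
      have e1 := h.apply_succ (j := y) (by omega) (by omega)
      have e2 := h.apply_succ (j := y + 1) (by omega) (by omega)
      push_cast at e2
      simp only [Nat.add_sub_cancel, Nat.cast_add, Nat.cast_one]
      rw [e1, e2]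
      omega
    · obtain rfl : x = i := by omega
      have e2 := h.apply_succ hxm le_rfl
      rw [hself, e2]
      omega

lemma InsertSpec.mem_NegSet_iff (h : InsertSpec (m + 1) σ τ i v) (hi1 : 1 ≤ i)
    (hi : i ≤ m + 1) (x : ℕ) :
    x ∈ NegSet (m + 1) τ ↔ x ∈ openGap i (NegSet m σ) ∨ (x = i ∧ v < 0) := by
  rw [mem_openGap, mem_NegSet, mem_NegSet, mem_NegSet]
  rcases lt_trichotomy x i with h1 | rfl | h1
  · rcases Nat.eq_zero_or_pos x with rfl | hx
    · omega
    rw [h.apply_lt hi hx h1]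
    omega
  · rw [h.apply_self hi hi1]
    omega
  · obtain ⟨y, rfl⟩ : ∃ y, x = y + 1 := ⟨x - 1, by omega⟩
    by_cases hy : y ≤ m
    · have e1 := h.apply_succ (j := y) (by omega) (by omega)
      simp only [Nat.add_sub_cancel, Nat.cast_add, Nat.cast_one]
      rw [e1]
      omega
    · omega

lemma InsertSpec.negStat_of_nonneg (h : InsertSpec (m + 1) σ τ i v) (hi1 : 1 ≤ i)
    (hi : i ≤ m + 1) (hv : 0 ≤ v) : negStat (m + 1) τ = negStat m σ := by
  have : NegSet (m + 1) τ = openGap i (NegSet m σ) := by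
    ext x
    rw [h.mem_NegSet_iff hi1 hi]
    simp [hv.not_gt]
  rw [negStat, this, card_openGap, negStat]

lemma InsertSpec.negStat_of_neg (h : InsertSpec (m + 1) σ τ i v) (hi1 : 1 ≤ i)
    (hi : i ≤ m + 1) (hv : v < 0) : negStat (m + 1) τ = negStat m σ + 1 := by
  have : NegSet (m + 1) τ = insert i (openGap i (NegSet m σ)) := by
    ext x
    rw [h.mem_NegSet_iff hi1 hi, Finset.mem_insert]
    tauto
  rw [negStat, this, Finset.card_insert_of_notMem (notMem_openGap _ _), card_openGap, negStat]

lemma IsSignedPerm.bounds_nat (hσ : IsSignedPerm m σ) {x : ℕ} (hx : x ≤ m) :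
    σ (x : ℤ) < ((m + 1 : ℕ) : ℤ) ∧ -((m + 1 : ℕ) : ℤ) < σ (x : ℤ) := by
  have := abs_le.1 (hσ.abs_apply_le (a := (x : ℤ)) (by simpa using hx))
  push_cast
  omega

lemma DesA_insert_pos_last (hσ : IsSignedPerm m σ)
    (h : InsertSpec (m + 1) σ τ (m + 1) ((m + 1 : ℕ) : ℤ)) :
    DesA (m + 1) τ = DesA m σ := by
  ext x
  rw [h.mem_DesA_iff (by omega) le_rfl, mem_openGap, Finset.mem_erase, Finset.mem_erase]
  have hb := fun hx => hσ.bounds_nat (x := x) hx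
  have hD := mem_DesA (n := m) (π := σ) (x := x)
  have hD' := mem_DesA (n := m) (π := σ) (x := x - 1)
  constructor
  · rintro (⟨-, h1⟩ | ⟨h1, h2⟩) <;> grind
  · intro h1
    have := hD.1 h1
    left; left
    exact ⟨by omega, by omega, h1⟩

lemma DesA_insert_pos (hσ : IsSignedPerm m σ) (hi1 : 1 ≤ i) (hi : i ≤ m)
    (h : InsertSpec (m + 1) σ τ i ((m + 1 : ℕ) : ℤ)) :
    DesA (m + 1) τ = insert i (openGap i ((DesA m σ).erase (i - 1))) := by
  ext x
  rw [h.mem_DesA_iff hi1 (by omega), Finset.mem_insert]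
  have hb := fun hx => (hσ.bounds_nat (x := x) hx).1
  have hb' := (hσ.bounds_nat hi).1
  constructor
  · rintro (h1 | h1 | ⟨h1, -, h2⟩)
    · exact Or.inr h1
    · exact Or.inl h1.1
    · exact absurd h2 (hb (by omega)).not_gt
  · rintro (rfl | h1)
    · exact Or.inr (Or.inl ⟨rfl, hi, hb'⟩)
    · exact Or.inl h1

lemma DesA_insert_neg_first (hσ : IsSignedPerm m σ)
    (h : InsertSpec (m + 1) σ τ 1 (-((m + 1 : ℕ) : ℤ))) :
    DesA (m + 1) τ = openGap 1 (DesA m σ) := by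
  ext x
  have h0 : 0 ∉ DesA m σ := by simp [mem_DesA]
  rw [h.mem_DesA_iff le_rfl (by omega), Nat.sub_self, Finset.erase_eq_of_notMem h0]
  constructor
  · rintro (h1 | ⟨-, h1, h2⟩ | h1)
    · exact h1
    · exact absurd h2 (hσ.bounds_nat h1).2.not_gt
    · omega
  · exact Or.inl

lemma DesA_insert_neg (hσ : IsSignedPerm m σ) (hi1 : 2 ≤ i) (hi : i ≤ m + 1)
    (h : InsertSpec (m + 1) σ τ i (-((m + 1 : ℕ) : ℤ))) :
    DesA (m + 1) τ = insert (i - 1) (openGap i ((DesA m σ).erase (i - 1))) := by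
  ext x
  rw [h.mem_DesA_iff (by omega) hi, Finset.mem_insert]
  constructor
  · rintro (h1 | ⟨-, h1, h2⟩ | ⟨h1, -⟩)
    · exact Or.inr h1
    · exact absurd h2 (hσ.bounds_nat h1).2.not_gt
    · omega
  · rintro (rfl | h1)
    · exact Or.inr (Or.inr ⟨by omega, by omega, (hσ.bounds_nat (by omega)).2⟩)
    · exact Or.inl h1

/-- The number of descents of `σ(1),…,σ(m)` at positions at least `i`. -/
def desFrom (m : ℕ) (σ : Equiv.Perm ℤ) (i : ℕ) : ℕ := ((DesA m σ).filter (i ≤ ·)).card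

lemma desFrom_one : desFrom m σ 1 = desA m σ := by
  rw [desFrom, desA, Finset.filter_true_of_mem]
  intro x hx
  exact (mem_DesA.1 hx).1.1

lemma desFrom_of_le (hm : 1 ≤ m) (hi : m ≤ i) : desFrom m σ i = 0 := by
  rw [desFrom, Finset.card_eq_zero, Finset.filter_eq_empty_iff]
  intro x hx
  have := (mem_DesA.1 hx).1
  omega

lemma desFrom_succ_of_mem (h : i ∈ DesA m σ) : desFrom m σ i = desFrom m σ (i + 1) + 1 := by
  have : (DesA m σ).filter (i ≤ ·) = insert i ((DesA m σ).filter (i + 1 ≤ ·)) := by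
    ext x
    simp only [Finset.mem_filter, Finset.mem_insert]
    grind
  rw [desFrom, this, Finset.card_insert_of_notMem (by simp), desFrom]

lemma desFrom_succ_of_notMem (h : i ∉ DesA m σ) : desFrom m σ i = desFrom m σ (i + 1) := by
  rw [desFrom, desFrom]
  congr 1
  ext x
  simp only [Finset.mem_filter]
  grind

lemma card_filter_erase_pred (hi : 1 ≤ i) :
    (((DesA m σ).erase (i - 1)).filter (i ≤ ·)).card = desFrom m σ i := by
  rw [desFrom]
  congr 1
  ext x
  simp only [Finset.mem_filter, Finset.mem_erase]
  grind

lemma InsertSpec.fd_eq (h : InsertSpec (m + 1) σ τ i v) (hi1 : 2 ≤ i) (hi : i ≤ m + 1) :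
    fd (m + 1) τ + 2 * desA m σ = fd m σ + 2 * desA (m + 1) τ := by
  have := h.apply_lt hi (j := 1) le_rfl (by omega)
  push_cast at this
  rw [fd, fd, this]
  omega

lemma stats_insert_pos_last (hm : 1 ≤ m) (hσ : IsSignedPerm m σ)
    (h : InsertSpec (m + 1) σ τ (m + 1) ((m + 1 : ℕ) : ℤ)) :
    fd (m + 1) τ = fd m σ ∧ fmaj (m + 1) τ = fmaj m σ := by
  have hD := DesA_insert_pos_last hσ h
  have hN := h.negStat_of_nonneg (by omega) le_rfl (by positivity)
  have hf := h.fd_eq (by omega) le_rfl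
  rw [desA, desA, hD] at hf
  rw [fmaj, fmaj, majA, majA, hD, hN]
  exact ⟨by omega, rfl⟩

lemma stats_insert_pos_first (hm : 1 ≤ m) (hσ : IsSignedPerm m σ)
    (h : InsertSpec (m + 1) σ τ 1 ((m + 1 : ℕ) : ℤ)) :
    fd (m + 1) τ = 2 * desA m σ + 2 ∧
      fmaj (m + 1) τ = fmaj m σ + 2 * (desA m σ + 1) := by
  have hD := DesA_insert_pos hσ le_rfl hm h
  have h0 : 0 ∉ DesA m σ := by simp [mem_DesA]
  rw [Nat.sub_self, Finset.erase_eq_of_notMem h0] at hD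
  have hN := h.negStat_of_nonneg le_rfl (by omega) (by positivity)
  have h1 := h.apply_self (by omega) le_rfl
  rw [Nat.cast_one] at h1
  constructor
  · rw [fd, h1, if_neg (by omega), desA, hD,
      Finset.card_insert_of_notMem (notMem_openGap _ _), card_openGap, desA]
    omega
  · rw [fmaj, fmaj, majA, majA, hD, hN, Finset.sum_insert (notMem_openGap _ _), sum_openGap,
      ← desFrom, desFrom_one]
    omega

lemma stats_insert_neg_first (hσ : IsSignedPerm m σ)
    (h : InsertSpec (m + 1) σ τ 1 (-((m + 1 : ℕ) : ℤ))) :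
    fd (m + 1) τ = 2 * desA m σ + 1 ∧
      fmaj (m + 1) τ = fmaj m σ + 2 * desA m σ + 1 := by
  have hD := DesA_insert_neg_first hσ h
  have hv : -((m + 1 : ℕ) : ℤ) < 0 := by omega
  have hN := h.negStat_of_neg le_rfl (by omega) hv
  have h1 := h.apply_self (by omega) le_rfl
  rw [Nat.cast_one] at h1
  constructor
  · rw [fd, h1, if_pos hv, desA, hD, card_openGap, desA]
  · rw [fmaj, fmaj, majA, majA, hD, hN, sum_openGap, ← desFrom, desFrom_one]
    omega

lemma stats_insert_pos_of_mem (hσ : IsSignedPerm m σ) (hi1 : 2 ≤ i) (hi : i ≤ m)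
    (h : InsertSpec (m + 1) σ τ i ((m + 1 : ℕ) : ℤ)) (hd : i - 1 ∈ DesA m σ) :
    fd (m + 1) τ = fd m σ ∧
      fmaj (m + 1) τ = fmaj m σ + 2 * (desFrom m σ i + 1) := by
  have hD := DesA_insert_pos hσ (by omega) hi h
  have hN := h.negStat_of_nonneg (by omega) (by omega) (by positivity)
  have hf := h.fd_eq hi1 (by omega)
  have hc := Finset.card_erase_add_one hd
  have hs := Finset.sum_erase_add _ (fun k => k) hd
  constructor
  · rw [desA, desA, hD, Finset.card_insert_of_notMem (notMem_openGap _ _), card_openGap] at hf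
    omega
  · rw [fmaj, fmaj, majA, majA, hD, hN, Finset.sum_insert (notMem_openGap _ _), sum_openGap,
      card_filter_erase_pred (by omega)]
    omega

lemma stats_insert_pos_of_notMem (hσ : IsSignedPerm m σ) (hi1 : 2 ≤ i) (hi : i ≤ m)
    (h : InsertSpec (m + 1) σ τ i ((m + 1 : ℕ) : ℤ)) (hd : i - 1 ∉ DesA m σ) :
    fd (m + 1) τ = fd m σ + 2 ∧
      fmaj (m + 1) τ = fmaj m σ + 2 * (i + desFrom m σ i) := by
  have hD := DesA_insert_pos hσ (by omega) hi h
  have hN := h.negStat_of_nonneg (by omega) (by omega) (by positivity)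
  have hf := h.fd_eq hi1 (by omega)
  have hc := card_filter_erase_pred (m := m) (σ := σ) (i := i) (by omega)
  rw [Finset.erase_eq_of_notMem hd] at hD hc
  constructor
  · rw [desA, desA, hD, Finset.card_insert_of_notMem (notMem_openGap _ _), card_openGap] at hf
    omega
  · rw [fmaj, fmaj, majA, majA, hD, hN, Finset.sum_insert (notMem_openGap _ _), sum_openGap, hc]
    omega

lemma pred_notMem_openGap_erase (D : Finset ℕ) (i : ℕ) :
    i - 1 ∉ openGap i (D.erase (i - 1)) := by
  rw [mem_openGap, Finset.mem_erase]
  rintro (⟨-, h, -⟩ | ⟨h, -⟩)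
  · exact h rfl
  · omega

lemma stats_insert_neg_of_mem (hσ : IsSignedPerm m σ) (hi1 : 2 ≤ i) (hi : i ≤ m + 1)
    (h : InsertSpec (m + 1) σ τ i (-((m + 1 : ℕ) : ℤ))) (hd : i - 1 ∈ DesA m σ) :
    fd (m + 1) τ = fd m σ ∧
      fmaj (m + 1) τ = fmaj m σ + 2 * desFrom m σ i + 1 := by
  have hD := DesA_insert_neg hσ hi1 hi h
  have hN := h.negStat_of_neg (by omega) hi (by omega)
  have hf := h.fd_eq hi1 hi
  have hc := Finset.card_erase_add_one hd
  have hs := Finset.sum_erase_add _ (fun k => k) hd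
  have hni := pred_notMem_openGap_erase (DesA m σ) i
  constructor
  · rw [desA, desA, hD, Finset.card_insert_of_notMem hni, card_openGap] at hf
    omega
  · rw [fmaj, fmaj, majA, majA, hD, hN, Finset.sum_insert hni, sum_openGap,
      card_filter_erase_pred (by omega)]
    omega

lemma stats_insert_neg_of_notMem (hσ : IsSignedPerm m σ) (hi1 : 2 ≤ i) (hi : i ≤ m + 1)
    (h : InsertSpec (m + 1) σ τ i (-((m + 1 : ℕ) : ℤ))) (hd : i - 1 ∉ DesA m σ) :
    fd (m + 1) τ = fd m σ + 2 ∧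
      fmaj (m + 1) τ = fmaj m σ + 2 * (i - 1 + desFrom m σ i) + 1 := by
  have hD := DesA_insert_neg hσ hi1 hi h
  have hN := h.negStat_of_neg (by omega) hi (by omega)
  have hf := h.fd_eq hi1 hi
  have hc := card_filter_erase_pred (m := m) (σ := σ) (i := i) (by omega)
  have hni := pred_notMem_openGap_erase (DesA m σ) i
  rw [Finset.erase_eq_of_notMem hd] at hD hc hni
  constructor
  · rw [desA, desA, hD, Finset.card_insert_of_notMem hni, card_openGap] at hf
    omega
  · rw [fmaj, fmaj, majA, majA, hD, hN, Finset.sum_insert hni, sum_openGap, hc]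
    omega

end Insertion

lemma qnumM_zero : qnumM 0 = 0 := rfl

lemma qnumM_succ (k : ℕ) : qnumM (k + 1) = qnumM k + MvPolynomial.X 1 ^ k :=
  Finset.sum_range_succ _ _

lemma X_sub_one_mul_qnumM (k : ℕ) :
    (MvPolynomial.X 1 - 1) * qnumM k = (MvPolynomial.X 1 ^ k - 1 : MvPolynomial (Fin 2) ℤ) :=
  mul_geom_sum _ _

lemma sum_Icc_one_add_two {M : Type*} [AddCommMonoid M] (f : ℕ → M) (k : ℕ) :
    ∑ i ∈ Finset.Icc 1 (k + 2), f i = f 1 + ∑ i ∈ Finset.range k, f (i + 2) + f (k + 2) := by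
  have : Finset.Icc 1 (k + 2) = Finset.Ico 1 (k + 3) := by ext; simp; omega
  rw [this, Finset.sum_Ico_eq_sum_range, Nat.add_sub_cancel (n := k + 2) (m := 1),
    Finset.sum_range_succ, Finset.sum_range_succ']
  rw [add_comm _ (f (1 + 0))]
  simp only [add_comm 1, add_assoc, Nat.reduceAdd, zero_add]

/-- The generating polynomial of the insertions at positions `j + 1, …, m`, relative to that
of `σ`. -/
noncomputable def innerInsertionPoly (m : ℕ) (σ : Equiv.Perm ℤ) (j : ℕ) :
    MvPolynomial (Fin 2) ℤ :=
  MvPolynomial.X 1 * qnumM (2 * desFrom m σ j) +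
    MvPolynomial.X 0 ^ 2 * (qnumM (2 * m + 1) - qnumM (2 * (j + desFrom m σ j) + 1))

lemma insertion_term_eq {m j : ℕ} {σ τ τ' : Equiv.Perm ℤ} (hσ : IsSignedPerm m σ)
    (hj : 1 ≤ j) (hjm : j + 1 ≤ m)
    (hp : InsertSpec (m + 1) σ τ (j + 1) ((m + 1 : ℕ) : ℤ))
    (hm : InsertSpec (m + 1) σ τ' (j + 1) (-((m + 1 : ℕ) : ℤ))) :
    (MvPolynomial.X 0 : MvPolynomial (Fin 2) ℤ) ^ fd (m + 1) τ *
          MvPolynomial.X 1 ^ fmaj (m + 1) τ +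
        MvPolynomial.X 0 ^ fd (m + 1) τ' * MvPolynomial.X 1 ^ fmaj (m + 1) τ' =
      MvPolynomial.X 0 ^ fd m σ * MvPolynomial.X 1 ^ fmaj m σ *
        (innerInsertionPoly m σ j - innerInsertionPoly m σ (j + 1)) := by
  rw [innerInsertionPoly, innerInsertionPoly]
  by_cases hd : j ∈ DesA m σ
  · obtain ⟨h1, h2⟩ := stats_insert_pos_of_mem hσ (by omega) hjm hp hd
    obtain ⟨h3, h4⟩ := stats_insert_neg_of_mem hσ (by omega) (by omega) hm hd
    rw [h1, h2, h3, h4, desFrom_succ_of_mem hd, mul_add 2 _ 1, mul_one, qnumM_succ, qnumM_succ,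
      show j + (desFrom m σ (j + 1) + 1) = j + 1 + desFrom m σ (j + 1) by ring]
    ring
  · obtain ⟨h1, h2⟩ := stats_insert_pos_of_notMem hσ (by omega) hjm hp hd
    obtain ⟨h3, h4⟩ := stats_insert_neg_of_notMem hσ (by omega) (by omega) hm hd
    rw [h1, h2, h3, h4, desFrom_succ_of_notMem hd, Nat.add_sub_cancel,
      show 2 * (j + 1 + desFrom m σ (j + 1)) + 1 =
        2 * (j + desFrom m σ (j + 1)) + 1 + 1 + 1 by ring, qnumM_succ (_ + 1 + 1),
      qnumM_succ (_ + 1)]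
    ring

theorem stmt_14 (n : ℕ) (hn : 3 ≤ n) (σ : Equiv.Perm ℤ) (hσ : IsSignedPerm (n - 1) σ)
    (τp τm : ℕ → Equiv.Perm ℤ)
    (hp : ∀ i ∈ Finset.Icc 1 n, InsertSpec n σ (τp i) i (n : ℤ))
    (hm : ∀ i ∈ Finset.Icc 1 n, InsertSpec n σ (τm i) i (-(n : ℤ))) :
    (∑ i ∈ Finset.Icc 1 n,
      ((MvPolynomial.X 0 : MvPolynomial (Fin 2) ℤ) ^ fd n (τp i) *
          MvPolynomial.X 1 ^ fmaj n (τp i) +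
        (MvPolynomial.X 0 : MvPolynomial (Fin 2) ℤ) ^ fd n (τm i) *
          MvPolynomial.X 1 ^ fmaj n (τm i))) =
    (MvPolynomial.X 0 : MvPolynomial (Fin 2) ℤ) ^ fd (n - 1) σ *
      MvPolynomial.X 1 ^ fmaj (n - 1) σ *
      (1 + MvPolynomial.X 1 * qnumM (fd (n - 1) σ) +
        MvPolynomial.X 0 * MvPolynomial.X 1 +
        MvPolynomial.X 0 * MvPolynomial.X 1 * (MvPolynomial.X 1 - 1) * qnumM (fd (n - 1) σ) +
        MvPolynomial.X 0 ^ 2 * MvPolynomial.X 1 ^ 2 *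
          (qnumM (2 * n - 2) - qnumM (fd (n - 1) σ))) := by
  obtain ⟨k, rfl⟩ : ∃ k, n = k + 2 := ⟨n - 2, by omega⟩
  rw [show k + 2 - 1 = k + 1 from rfl] at hσ ⊢
  have hp' : ∀ i, 1 ≤ i → i ≤ k + 2 → InsertSpec (k + 1 + 1) σ (τp i) i ((k + 1 + 1 : ℕ) : ℤ) :=
    fun i h1 h2 => hp i (Finset.mem_Icc.2 ⟨h1, h2⟩)
  have hm' : ∀ i, 1 ≤ i → i ≤ k + 2 →
      InsertSpec (k + 1 + 1) σ (τm i) i (-((k + 1 + 1 : ℕ) : ℤ)) :=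
    fun i h1 h2 => hm i (Finset.mem_Icc.2 ⟨h1, h2⟩)
  have hinner := Finset.sum_congr rfl fun i (hi : i ∈ Finset.range k) =>
    have hi' := Finset.mem_range.1 hi
    insertion_term_eq (j := i + 1) hσ (by omega) (by omega)
      (hp' (i + 2) (by omega) (by omega)) (hm' (i + 2) (by omega) (by omega))
  rw [← Finset.mul_sum, Finset.sum_range_sub' (fun i => innerInsertionPoly (k + 1) σ (i + 1)) k]
    at hinner
  have hlast : k + 2 - 1 ∉ DesA (k + 1) σ := by rw [mem_DesA]; omega
  obtain ⟨a1, a2⟩ := stats_insert_pos_first (by omega) hσ (hp' 1 le_rfl (by omega))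
  obtain ⟨a3, a4⟩ := stats_insert_neg_first hσ (hm' 1 le_rfl (by omega))
  obtain ⟨a5, a6⟩ := stats_insert_pos_last (by omega) hσ (hp' (k + 2) (by omega) le_rfl)
  obtain ⟨a7, a8⟩ := stats_insert_neg_of_notMem hσ (by omega) (by omega)
    (hm' (k + 2) (by omega) le_rfl) hlast
  rw [sum_Icc_one_add_two, hinner, a1, a2, a3, a4, a5, a6, a7, a8, innerInsertionPoly,
    innerInsertionPoly, zero_add, desFrom_one, desFrom_of_le (by omega) le_rfl,
    desFrom_of_le (by omega) (by omega), mul_assoc (_ * _) (_ - _), X_sub_one_mul_qnumM,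
    show 2 * (k + 2) - 2 = 2 * (k + 1) by omega, show k + 2 - 1 + 0 = k + 1 from rfl, add_zero,
    sub_self, show 2 * (1 + desA (k + 1) σ) + 1 = 2 * desA (k + 1) σ + 1 + 1 + 1 by ring]
  generalize fmaj (k + 1) σ = M
  rw [fd]
  generalize desA (k + 1) σ = d
  have hk := X_sub_one_mul_qnumM (2 * (k + 1))
  have hd := X_sub_one_mul_qnumM (2 * d)
  split_ifs <;> simp only [qnumM_succ, add_zero, qnumM_zero, mul_zero]
  · linear_combination (MvPolynomial.X 0 ^ (2 * d + 1) * MvPolynomial.X 1 ^ M *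
      MvPolynomial.X 0 ^ 2 * (MvPolynomial.X 1 + 1)) * (hd - hk)
  · linear_combination (MvPolynomial.X 0 ^ (2 * d) * MvPolynomial.X 1 ^ M *
      MvPolynomial.X 0 ^ 2 * (MvPolynomial.X 1 + 1)) * (hd - hk)
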